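/- Let X be the set of functions u : ℝ → ℝ with u' ∈ BV_loc(ℝ, {±1}), let X_R = {u ∈ X : u(−R/2) = u(R/2) = 0}, and set f^ω_{R,m}(u) = (1/R)( A₀ ‖u'‖_{BV(−R/2,R/2)} + m ∫_{−R/2}^{R/2} a(ω,t) u(t)² dt ), where 1 ≤ a ≤ 2. Then, assuming 0 < α ≤ m ≤ β and R > 1, there is a constant C depending only on α and β such that inf over X_R of f^ω_{R,m} ≤ ( inf over X of f^ω_{R,m} ) + C/R. -/

import Mathlib

open Filter Topology MeasureTheory Metric ENNReal

noncomputable section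

/-- A sawtooth function on `ℝ`: `u` is the integral of a `±1`-valued function `g` of
locally bounded variation, i.e. `u' ∈ BV_loc(ℝ, ±1)`. -/
def SawtoothLoc (u g : ℝ → ℝ) : Prop :=
  (∀ t, g t = 1 ∨ g t = -1) ∧
  (∀ s₁ s₂ : ℝ, u s₂ = u s₁ + ∫ t in s₁..s₂, g t) ∧
  ∀ b₁ b₂ : ℝ, eVariationOn g (Set.Icc b₁ b₂) < ∞

/-- The sharp interface functional
`f^ω_{R,m}(u) = (1/R)(A₀‖u'‖_{BV(-R/2,R/2)} + m ∫_{-R/2}^{R/2} a(t) u(t)² dt)`,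
evaluated on a sawtooth function `u` with derivative representative `g`. -/
def fRm (A₀ : ℝ) (a : ℝ → ℝ) (R mval : ℝ) (u g : ℝ → ℝ) : ℝ≥0∞ :=
  ENNReal.ofReal R⁻¹ *
    (ENNReal.ofReal A₀ * eVariationOn g (Set.Ioo (-(R / 2)) (R / 2)) +
      ENNReal.ofReal mval *
        ∫⁻ t in Set.Ioo (-(R / 2)) (R / 2), ENNReal.ofReal (a t * u t ^ 2))

theorem eVariationOn_max_le (f g : ℝ → ℝ) (s : Set ℝ) :
    eVariationOn (fun t => max (f t) (g t)) s ≤ eVariationOn f s + eVariationOn g s := by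
  refine iSup_le fun ⟨n, w, hw, hws⟩ => ?_
  calc ∑ i ∈ Finset.range n,
        edist (max (f (w (i + 1))) (g (w (i + 1)))) (max (f (w i)) (g (w i)))
      ≤ ∑ i ∈ Finset.range n,
        (edist (f (w (i + 1))) (f (w i)) + edist (g (w (i + 1))) (g (w i))) := by
        refine Finset.sum_le_sum fun i _ => ?_
        simp only [edist_dist, Real.dist_eq]
        rw [← ENNReal.ofReal_add (abs_nonneg _) (abs_nonneg _)]
        refine ENNReal.ofReal_le_ofReal ((abs_max_sub_max_le_max _ _ _ _).trans ?_)
        exact max_le_add_of_nonneg (abs_nonneg _) (abs_nonneg _)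
    _ ≤ _ := by
        rw [Finset.sum_add_distrib]
        exact add_le_add (eVariationOn.sum_le hw hws) (eVariationOn.sum_le hw hws)

theorem eVariationOn_neg (f : ℝ → ℝ) (s : Set ℝ) :
    eVariationOn (fun t => -f t) s = eVariationOn f s := by
  simp [eVariationOn, edist_neg_neg]

theorem eVariationOn_comp_neg (f : ℝ → ℝ) (s : Set ℝ) :
    eVariationOn (fun t => f (-t)) s = eVariationOn f (-s) := by
  rw [← Set.image_neg_eq_neg]
  exact eVariationOn.comp_eq_of_antitoneOn f (fun t => -t) (fun _ _ _ _ h => neg_le_neg h)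

theorem intervalIntegrable_of_eVariationOn_Icc_lt_top {g : ℝ → ℝ}
    (hg : ∀ b₁ b₂ : ℝ, eVariationOn g (Set.Icc b₁ b₂) < ∞) (a b : ℝ) :
    IntervalIntegrable g volume a b := by
  have h : LocallyBoundedVariationOn g Set.univ := fun x y _ _ => by
    simpa [BoundedVariationOn] using (hg x y).ne
  obtain ⟨p, q, hp, hq, rfl⟩ := h.exists_monotoneOn_sub_monotoneOn
  exact (hp.mono (Set.subset_univ _)).intervalIntegrable.sub
    (hq.mono (Set.subset_univ _)).intervalIntegrable

namespace SawtoothLoc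

variable {u g : ℝ → ℝ}

theorem neg (h : SawtoothLoc u g) : SawtoothLoc (fun t => -u t) (fun t => -g t) := by
  refine ⟨fun t => ?_, fun s₁ s₂ => ?_, fun b₁ b₂ => ?_⟩
  · rcases h.1 t with h | h <;> simp [h]
  · dsimp only
    rw [intervalIntegral.integral_neg, h.2.1 s₁ s₂]; ring
  · rw [eVariationOn_neg]; exact h.2.2 b₁ b₂

theorem comp_neg (h : SawtoothLoc u g) :
    SawtoothLoc (fun t => u (-t)) (fun t => -g (-t)) := by
  refine ⟨fun t => ?_, fun s₁ s₂ => ?_, fun b₁ b₂ => ?_⟩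
  · rcases h.1 (-t) with h | h <;> simp [h]
  · dsimp only
    rw [intervalIntegral.integral_neg, intervalIntegral.integral_comp_neg,
      h.2.1 (-s₁) (-s₂), intervalIntegral.integral_symm (-s₂) (-s₁)]
  · rw [eVariationOn_neg (fun t => g (-t)), eVariationOn_comp_neg]
    simpa using h.2.2 (-b₂) (-b₁)

theorem abs_sub_le (h : SawtoothLoc u g) (s t : ℝ) : |u t - u s| ≤ |t - s| := by
  have := intervalIntegral.norm_integral_le_of_norm_le_const (f := g) (a := s) (b := t) (C := 1)
    fun x _ => by rcases h.1 x with h | h <;> simp [h]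
  rw [h.2.1 s t]
  simpa using this

theorem continuous (h : SawtoothLoc u g) : Continuous u := by
  refine (LipschitzWith.of_dist_le_mul (K := 1) fun x y => ?_).continuous
  simpa [Real.dist_eq] using h.abs_sub_le y x

theorem exists_right_eq_zero_of_nonpos (h : SawtoothLoc u g) {r : ℝ} (hr : 0 ≤ r)
    (hur : u r ≤ 0) :
    ∃ v k : ℝ → ℝ, SawtoothLoc v k ∧ v r = 0 ∧ (∀ t ∈ Set.Icc (-r) r, |v t| ≤ |u t|) ∧
      eVariationOn k (Set.Ioo (-r) r) ≤ eVariationOn g (Set.Ioo (-r) r) + 2 := by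
  have hanti : ∀ s t, s ≤ t → u t - (t - r) ≤ u s - (s - r) := fun s t hst => by
    have := (le_abs_self _).trans (h.abs_sub_le s t)
    rw [abs_of_nonneg (sub_nonneg.2 hst)] at this
    linarith
  obtain ⟨t₀, ht₀, hle, hor⟩ : ∃ t₀ ∈ Set.Icc (-r) r, u t₀ ≤ t₀ - r ∧
      (t₀ = -r ∨ u t₀ = t₀ - r) := by
    by_cases hneg : u (-r) ≤ -r - r
    · exact ⟨-r, ⟨le_rfl, by linarith⟩, hneg, .inl rfl⟩
    · push Not at hneg
      have hcont : ContinuousOn (fun t => u t - (t - r)) (Set.Icc (-r) r) :=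
        (h.continuous.sub (continuous_id.sub continuous_const)).continuousOn
      obtain ⟨t₀, ht₀, h0⟩ := intermediate_value_Icc' (by linarith : -r ≤ r) hcont
        (show (0 : ℝ) ∈ Set.Icc _ _ from ⟨by simpa using hur, by linarith⟩)
      have h0 : u t₀ - (t₀ - r) = 0 := h0
      exact ⟨t₀, ht₀, by linarith, .inr (by linarith)⟩
  set j : ℝ → ℝ := fun t => if t ≤ t₀ then -1 else 1 with hj
  have hjmono : Monotone j := fun s t hst => by
    simp only [hj]
    split_ifs <;> linarith
  have hjvar : ∀ b₁ b₂, eVariationOn j (Set.Icc b₁ b₂) ≤ 2 := fun b₁ b₂ => by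
    have := (hjmono.monotoneOn Set.univ).eVariationOn_eq (Set.mem_univ b₁) (Set.mem_univ b₂)
    rw [Set.univ_inter] at this
    refine this.trans_le ?_
    rw [show (2 : ℝ≥0∞) = ENNReal.ofReal 2 by simp]
    apply ENNReal.ofReal_le_ofReal
    simp only [hj]
    split_ifs <;> norm_num
  set k : ℝ → ℝ := fun t => max (g t) (j t) with hk
  have hkl : ∀ t, t ≤ t₀ → k t = g t := fun t ht => by
    simp only [hk, hj, if_pos ht]
    rcases h.1 t with h | h <;> norm_num [h]
  have hkr : ∀ t, t₀ < t → k t = 1 := fun t ht => by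
    simp only [hk, hj, if_neg (not_le.2 ht)]
    rcases h.1 t with h | h <;> norm_num [h]
  have hkvar : ∀ b₁ b₂, eVariationOn k (Set.Icc b₁ b₂) < ∞ := fun b₁ b₂ =>
    (eVariationOn_max_le g j _).trans_lt <| ENNReal.add_lt_top.2
      ⟨h.2.2 b₁ b₂, (hjvar b₁ b₂).trans_lt (by simp)⟩
  have hkint := intervalIntegrable_of_eVariationOn_Icc_lt_top hkvar
  have hvr : ∀ t, t₀ ≤ t → t ≤ r → ∫ x in r..t, k x = t - r := fun t ht htr => by
    rw [intervalIntegral.integral_congr_ae (g := fun _ => (1 : ℝ))]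
    · simp
    · refine .of_forall fun x hx => hkr x ?_
      rw [Set.uIoc_of_ge htr] at hx
      exact ht.trans_lt hx.1
  refine ⟨fun t => ∫ x in r..t, k x, k, ⟨fun t => ?_, fun s₁ s₂ => ?_, hkvar⟩, by simp,
    fun t ht => ?_, ?_⟩
  · rcases le_or_gt t t₀ with ht | ht
    · rw [hkl t ht]; exact h.1 t
    · exact .inl (hkr t ht)
  · exact (intervalIntegral.integral_add_adjacent_intervals (hkint _ _) (hkint _ _)).symm
  · rcases le_total t₀ t with htt | htt
    · dsimp only
      rw [hvr t htt ht.2, abs_of_nonpos (by linarith [ht.2]),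
        abs_of_nonpos (by linarith [hanti t₀ t htt, ht.2])]
      linarith [hanti t₀ t htt]
    · rcases hor with h0 | h0
      · have : t = t₀ := le_antisymm htt (h0 ▸ ht.1)
        subst this
        dsimp only
        rw [hvr t le_rfl ht.2, abs_of_nonpos (by linarith [ht.2]),
          abs_of_nonpos (by linarith [ht.2])]
        linarith
      · have : ∫ x in r..t, k x = u t := by
          rw [← intervalIntegral.integral_add_adjacent_intervals (hkint r t₀) (hkint t₀ t),
            hvr t₀ le_rfl ht₀.2, h.2.1 t₀ t, h0]
          congr 1
          refine intervalIntegral.integral_congr_ae (.of_forall fun x hx => hkl x ?_)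
          rw [Set.uIoc_of_ge htt] at hx
          exact hx.2
        simp only [this, le_refl]
  · refine (eVariationOn_max_le g j _).trans (add_le_add le_rfl ?_)
    exact (eVariationOn.mono j Set.Ioo_subset_Icc_self).trans (hjvar _ _)

theorem exists_right_eq_zero (h : SawtoothLoc u g) {r : ℝ} (hr : 0 ≤ r) :
    ∃ v k : ℝ → ℝ, SawtoothLoc v k ∧ v r = 0 ∧ (∀ t ∈ Set.Icc (-r) r, |v t| ≤ |u t|) ∧
      eVariationOn k (Set.Ioo (-r) r) ≤ eVariationOn g (Set.Ioo (-r) r) + 2 := by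
  rcases le_total (u r) 0 with hu | hu
  · exact h.exists_right_eq_zero_of_nonpos hr hu
  · obtain ⟨v, k, hv, h0, hle, hvar⟩ :=
      h.neg.exists_right_eq_zero_of_nonpos hr (neg_nonpos.2 hu)
    refine ⟨_, _, hv.neg, by simp [h0], fun t ht => by simpa using hle t ht, ?_⟩
    rwa [eVariationOn_neg, ← eVariationOn_neg g]

theorem exists_left_eq_zero (h : SawtoothLoc u g) {r : ℝ} (hr : 0 ≤ r) :
    ∃ v k : ℝ → ℝ, SawtoothLoc v k ∧ v (-r) = 0 ∧ (∀ t ∈ Set.Icc (-r) r, |v t| ≤ |u t|) ∧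
      eVariationOn k (Set.Ioo (-r) r) ≤ eVariationOn g (Set.Ioo (-r) r) + 2 := by
  obtain ⟨v, k, hv, h0, hle, hvar⟩ := h.comp_neg.exists_right_eq_zero hr
  refine ⟨_, _, hv.comp_neg, by simp [h0], fun t ht => ?_, ?_⟩
  · simpa using hle (-t) ⟨neg_le_neg ht.2, neg_le.1 ht.1⟩
  · rw [eVariationOn_neg (fun t => g (-t)), eVariationOn_comp_neg] at hvar
    rw [eVariationOn_neg (fun t => k (-t)), eVariationOn_comp_neg]
    simpa using hvar

theorem exists_boundary_eq_zero (h : SawtoothLoc u g) {r : ℝ} (hr : 0 ≤ r) :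
    ∃ v k : ℝ → ℝ, (SawtoothLoc v k ∧ v (-r) = 0 ∧ v r = 0) ∧
      (∀ t ∈ Set.Icc (-r) r, |v t| ≤ |u t|) ∧
      eVariationOn k (Set.Ioo (-r) r) ≤ eVariationOn g (Set.Ioo (-r) r) + 4 := by
  obtain ⟨v, k, hv, hv0, hvu, hkg⟩ := h.exists_left_eq_zero hr
  obtain ⟨w, l, hw, hw0, hwv, hlk⟩ := hv.exists_right_eq_zero hr
  refine ⟨w, l, ⟨hw, ?_, hw0⟩, fun t ht => (hwv t ht).trans (hvu t ht), ?_⟩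
  · simpa [hv0] using hwv (-r) ⟨le_rfl, by linarith⟩
  · refine hlk.trans ((add_le_add hkg le_rfl).trans_eq ?_)
    rw [add_assoc]; norm_num

end SawtoothLoc

/-- Imposing the boundary conditions `u(±R/2) = 0` raises the infimum of the sharp
interface functional `f^ω_{R,m}` over sawtooth functions by at most `C/R`, with `C`
depending only on `α` and `β`. -/
theorem zero_boundary_infimum_comparison
    (α β A₀ : ℝ) (hα : 0 < α) (hαβ : α ≤ β) (hA₀ : 0 < A₀) :
    ∃ C : ℝ, ∀ a : ℝ → ℝ, Measurable a → (∀ t, 1 ≤ a t ∧ a t ≤ 2) →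
      ∀ R : ℝ, 1 < R → ∀ mval : ℝ, α ≤ mval → mval ≤ β →
        (⨅ (u : ℝ → ℝ) (g : ℝ → ℝ)
          (_ : SawtoothLoc u g ∧ u (-(R / 2)) = 0 ∧ u (R / 2) = 0),
            fRm A₀ a R mval u g) ≤
          (⨅ (u : ℝ → ℝ) (g : ℝ → ℝ) (_ : SawtoothLoc u g), fRm A₀ a R mval u g) +
            ENNReal.ofReal (C / R) := by
  refine ⟨4 * A₀, fun a _ ha R hR mval _ _ => ?_⟩
  rw [← tsub_le_iff_right]
  refine le_iInf fun u => le_iInf fun g => le_iInf fun h => ?_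
  rw [tsub_le_iff_right]
  obtain ⟨v, k, hv, hvu, hkg⟩ := h.exists_boundary_eq_zero (r := R / 2) (by linarith)
  refine (iInf₂_le_of_le v k (iInf_le _ hv)).trans ?_
  have hint : ∫⁻ t in Set.Ioo (-(R / 2)) (R / 2), ENNReal.ofReal (a t * v t ^ 2) ≤
      ∫⁻ t in Set.Ioo (-(R / 2)) (R / 2), ENNReal.ofReal (a t * u t ^ 2) :=
    setLIntegral_mono' measurableSet_Ioo fun t ht => ENNReal.ofReal_le_ofReal <|
      mul_le_mul_of_nonneg_left (sq_le_sq.2 (hvu t (Set.Ioo_subset_Icc_self ht)))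
        (zero_le_one.trans (ha t).1)
  have hC : ENNReal.ofReal (4 * A₀ / R) =
      ENNReal.ofReal R⁻¹ * (ENNReal.ofReal A₀ * 4) := by
    rw [show (4 : ℝ≥0∞) = ENNReal.ofReal 4 by simp, ← ENNReal.ofReal_mul hA₀.le,
      ← ENNReal.ofReal_mul (by positivity)]
    congr 1
    ring
  rw [hC, fRm, fRm, ← mul_add, add_right_comm, ← mul_add]
  gcongr
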